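/- arXiv:2002.08843 — 7 statements merged into one kernel-verified Lean document; each statement's English description precedes it below -/
import Mathlib

section
/- Let 0 < μ₋ < μ₊ be real constants. The function g : (μ₋, μ₊) × ℝ² → ℝ defined by g(μ, x₁, x₂) = (μ·μ₋·μ₊·x₁² − 2·μ₋·μ₊·x₁·x₂ + (μ₊ + μ₋ − μ)·x₂²) / ((μ₊ − μ)(μ − μ₋)) is convex on the convex set (μ₋, μ₊) × ℝ². -/
/-- The function `(y, t) ↦ y² / t` is convex on the half-plane `t > 0`. -/
theorem convexOn_sq_div :
    ConvexOn ℝ ((Set.univ : Set ℝ) ×ˢ Set.Ioi (0 : ℝ)) (fun q : ℝ × ℝ => q.1 ^ 2 / q.2) := by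
  refine ⟨convex_univ.prod (convex_Ioi 0), ?_⟩
  rintro ⟨y, s⟩ ⟨-, hs⟩ ⟨z, t⟩ ⟨-, ht⟩ a b ha hb hab
  have hst := convex_Ioi (0 : ℝ) hs ht ha hb hab
  simp only [Set.mem_Ioi, smul_eq_mul] at hs ht hst
  simp only [Prod.smul_mk, Prod.mk_add_mk, smul_eq_mul]
  rw [div_le_iff₀ hst, ← sub_nonneg]
  have key : (a * (y ^ 2 / s) + b * (z ^ 2 / t)) * (a * s + b * t) - (a * y + b * z) ^ 2
      = a * b * (y * t - z * s) ^ 2 / (s * t) := by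
    field_simp
    ring
  rw [key]
  positivity

/-- For fixed `0 < μ₋ < μ₊`, the function
`g(μ, x₁, x₂) = (μ μ₋ μ₊ x₁² − 2 μ₋ μ₊ x₁ x₂ + (μ₊ + μ₋ − μ) x₂²) / ((μ₊ − μ)(μ − μ₋))`
is convex on the convex set `(μ₋, μ₊) × ℝ²`. -/
theorem g_convex (μm μp : ℝ) (hμm : 0 < μm) (hμ : μm < μp) :
    ConvexOn ℝ (Set.Ioo μm μp ×ˢ (Set.univ : Set (ℝ × ℝ)))
      (fun p : ℝ × ℝ × ℝ =>
        (p.1 * μm * μp * p.2.1 ^ 2 - 2 * μm * μp * p.2.1 * p.2.2 +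
            (μp + μm - p.1) * p.2.2 ^ 2) / ((μp - p.1) * (p.1 - μm))) := by
  have hconv : Convex ℝ (Set.Ioo μm μp ×ˢ (Set.univ : Set (ℝ × ℝ))) :=
    (convex_Ioo μm μp).prod convex_univ
  have hd : 0 < μp - μm := sub_pos.2 hμ
  have hp : ConvexOn ℝ (Set.Ioo μm μp ×ˢ (Set.univ : Set (ℝ × ℝ)))
      (fun p : ℝ × ℝ × ℝ => (μp * p.2.1 - p.2.2) ^ 2 / (μp - p.1)) := by
    refine ⟨hconv, ?_⟩
    rintro ⟨μ, x₁, x₂⟩ ⟨⟨-, h⟩, -⟩ ⟨ν, y₁, y₂⟩ ⟨⟨-, h'⟩, -⟩ a b ha hb hab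
    have := convexOn_sq_div.2 (x := (μp * x₁ - x₂, μp - μ)) ⟨trivial, sub_pos.2 h⟩
      (y := (μp * y₁ - y₂, μp - ν)) ⟨trivial, sub_pos.2 h'⟩ ha hb hab
    simp only [Prod.smul_mk, Prod.mk_add_mk, smul_eq_mul] at this ⊢
    convert this using 2
    · ring
    · linear_combination -μp * hab
  have hm : ConvexOn ℝ (Set.Ioo μm μp ×ˢ (Set.univ : Set (ℝ × ℝ)))
      (fun p : ℝ × ℝ × ℝ => (μm * p.2.1 - p.2.2) ^ 2 / (p.1 - μm)) := by
    refine ⟨hconv, ?_⟩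
    rintro ⟨μ, x₁, x₂⟩ ⟨⟨h, -⟩, -⟩ ⟨ν, y₁, y₂⟩ ⟨⟨h', -⟩, -⟩ a b ha hb hab
    have := convexOn_sq_div.2 (x := (μm * x₁ - x₂, μ - μm)) ⟨trivial, sub_pos.2 h⟩
      (y := (μm * y₁ - y₂, ν - μm)) ⟨trivial, sub_pos.2 h'⟩ ha hb hab
    simp only [Prod.smul_mk, Prod.mk_add_mk, smul_eq_mul] at this ⊢
    convert this using 2
    · ring
    · linear_combination μm * hab
  refine ((hp.smul (c := μm / (μp - μm)) (by positivity)).add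
    (hm.smul (c := μp / (μp - μm)) (div_nonneg (hμm.trans hμ).le hd.le))).congr ?_
  rintro ⟨μ, x₁, x₂⟩ ⟨⟨h, h'⟩, -⟩
  have h₁ : μ - μm ≠ 0 := (sub_pos.2 h).ne'
  have h₂ : μp - μ ≠ 0 := (sub_pos.2 h').ne'
  have h₃ : μp - μm ≠ 0 := hd.ne'
  simp only [Pi.add_apply, smul_eq_mul]
  field_simp
  ring
end

section
/- The function Q, defined on the convex set Z₀ = {z ∈ Z : μ₋ < μ < μ₊} by Q(z) = λ_max(M(z)), is convex on Z₀. -/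
noncomputable section

open Matrix

abbrev En (n : ℕ) := EuclideanSpace ℝ (Fin n)

/-- The space of symmetric trace-free `n × n` real matrices, as a submodule. -/
def S0 (n : ℕ) : Submodule ℝ (Matrix (Fin n) (Fin n) ℝ) where
  carrier := {σ | σ.IsSymm ∧ σ.trace = 0}
  add_mem' := fun hA hB => ⟨hA.1.add hB.1, by simp [Matrix.trace_add, hA.2, hB.2]⟩
  zero_mem' := ⟨Matrix.isSymm_zero, by simp⟩
  smul_mem' := fun c A hA => ⟨by rw [Matrix.IsSymm, Matrix.transpose_smul, hA.1], by simp [hA.2]⟩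

/-- The state space `Z = ℝ × ℝⁿ × ℝⁿ × S₀ × ℝ`. -/
abbrev Zsp (n : ℕ) := ℝ × En n × En n × ↥(S0 n) × ℝ

/-- Outer product `w ⊗ m`. -/
def op {n : ℕ} (w m : En n) : Matrix (Fin n) (Fin n) ℝ := fun i j => w i * m j

/-- The largest eigenvalue of a (symmetric) matrix, as `sup {ξᵀ A ξ : |ξ| = 1}`. -/
def lamMax {n : ℕ} (A : Matrix (Fin n) (Fin n) ℝ) : ℝ :=
  sSup {r | ∃ ξ : En n, ‖ξ‖ = 1 ∧ r = ∑ i, ∑ j, ξ i * A i j * ξ j}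

/-- The matrix `M(z)`. -/
def Mmat {n : ℕ} (μm μp μ : ℝ) (w m : En n) (σ : Matrix (Fin n) (Fin n) ℝ) :
    Matrix (Fin n) (Fin n) ℝ :=
  (((μp - μ) * (μ - μm))⁻¹) •
      ((μ * μm * μp) • op w w - (μm * μp) • (op m w + op w m) + (μp + μm - μ) • op m m) - σ

/-- `T₊(z)`. -/
def Tp {n : ℕ} (μm μp μ : ℝ) (w m : En n) : ℝ :=
  (μp / (n : ℝ)) * ‖m - μm • w‖ ^ 2 / (μ - μm) ^ 2

/-- `T₋(z)`. -/
def Tm {n : ℕ} (μm μp μ : ℝ) (w m : En n) : ℝ :=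
  (μm / (n : ℝ)) * ‖m - μp • w‖ ^ 2 / (μ - μp) ^ 2

def TpZ {n : ℕ} (μm μp : ℝ) (z : Zsp n) : ℝ := Tp μm μp z.1 z.2.1 z.2.2.1

def TmZ {n : ℕ} (μm μp : ℝ) (z : Zsp n) : ℝ := Tm μm μp z.1 z.2.1 z.2.2.1

def QZ {n : ℕ} (μm μp : ℝ) (z : Zsp n) : ℝ :=
  lamMax (Mmat μm μp z.1 z.2.1 z.2.2.1 (z.2.2.2.1 : Matrix (Fin n) (Fin n) ℝ))

/-- The open relaxed set `U`. -/
def Uset (n : ℕ) (μm μp e : ℝ) : Set (Zsp n) :=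
  {z | z.1 ∈ Set.Ioo μm μp ∧ TpZ μm μp z < e ∧ TmZ μm μp z < e ∧ QZ μm μp z < e}

/-- The constraint set `K`. -/
def Kset (n : ℕ) (μm μp e : ℝ) : Set (Zsp n) :=
  {z | (z.1 = μm ∨ z.1 = μp) ∧ z.2.2.1 = z.1 • z.2.1 ∧
    z.1 • op z.2.1 z.2.1 - (z.2.2.2.1 : Matrix (Fin n) (Fin n) ℝ) =
      e • (1 : Matrix (Fin n) (Fin n) ℝ)}

/-- The wave cone `Λ`. -/
def Lambda (n : ℕ) : Set (Zsp n) :=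
  {z | ¬(z.1 = 0 ∧ z.2.2.1 = 0) ∧
    ∃ (ξ : Fin n → ℝ) (c : ℝ), ¬(ξ = 0 ∧ c = 0) ∧
      ((z.2.2.2.1 : Matrix (Fin n) (Fin n) ℝ) +
          z.2.2.2.2 • (1 : Matrix (Fin n) (Fin n) ℝ)).mulVec ξ + c • (fun i => z.2.2.1 i) = 0 ∧
      (∑ j, z.2.2.1 j * ξ j) + c * z.1 = 0 ∧
      (∑ j, z.2.1 j * ξ j) = 0}

/-- The projection `π(μ, w, m, σ, q) = (μ, w, m, σ)`. -/
def pz {n : ℕ} (z : Zsp n) : ℝ × En n × En n × ↥(S0 n) := (z.1, z.2.1, z.2.2.1, z.2.2.2.1)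

theorem sq_div_convex_comb_le {t s x₁ x₂ y₁ y₂ : ℝ} (ht : 0 ≤ t) (hs : 0 ≤ s) (hy₁ : 0 < y₁)
    (hy₂ : 0 < y₂) (hy : 0 < t * y₁ + s * y₂) :
    (t * x₁ + s * x₂) ^ 2 / (t * y₁ + s * y₂) ≤ t * (x₁ ^ 2 / y₁) + s * (x₂ ^ 2 / y₂) := by
  have tangent (x y c : ℝ) (hy : 0 < y) : 2 * x * c - c ^ 2 * y ≤ x ^ 2 / y := by
    rw [le_div_iff₀ hy]
    nlinarith [sq_nonneg (x - c * y)]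
  set c := (t * x₁ + s * x₂) / (t * y₁ + s * y₂) with hc
  have h : (t * x₁ + s * x₂) ^ 2 / (t * y₁ + s * y₂) =
      t * (2 * x₁ * c - c ^ 2 * y₁) + s * (2 * x₂ * c - c ^ 2 * y₂) := by
    have hX : t * x₁ + s * x₂ = c * (t * y₁ + s * y₂) := by rw [hc, div_mul_cancel₀ _ hy.ne']
    rw [div_eq_iff hy.ne']
    linear_combination ((t * x₁ + s * x₂) - c * (t * y₁ + s * y₂)) * hX
  rw [h]
  gcongr <;> exact tangent _ _ _ ‹_›

/-- The quadratic form `ξᵀ A ξ`. -/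
def quadForm {n : ℕ} (A : Matrix (Fin n) (Fin n) ℝ) (ξ : En n) : ℝ :=
  ∑ i, ∑ j, ξ i * A i j * ξ j

theorem quadForm_op {n : ℕ} (u v ξ : En n) :
    quadForm (op u v) ξ = (∑ i, ξ i * u i) * ∑ j, ξ j * v j := by
  simp only [quadForm, op, Finset.sum_mul_sum]
  exact Finset.sum_congr rfl fun i _ => Finset.sum_congr rfl fun j _ => by ring

theorem quadForm_add {n : ℕ} (A B : Matrix (Fin n) (Fin n) ℝ) (ξ : En n) :
    quadForm (A + B) ξ = quadForm A ξ + quadForm B ξ := by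
  simp [quadForm, mul_add, add_mul, Finset.sum_add_distrib]

theorem quadForm_sub {n : ℕ} (A B : Matrix (Fin n) (Fin n) ℝ) (ξ : En n) :
    quadForm (A - B) ξ = quadForm A ξ - quadForm B ξ := by
  simp [quadForm, mul_sub, sub_mul, Finset.sum_sub_distrib]

theorem quadForm_smul {n : ℕ} (c : ℝ) (A : Matrix (Fin n) (Fin n) ℝ) (ξ : En n) :
    quadForm (c • A) ξ = c * quadForm A ξ := by
  simp only [quadForm, Finset.mul_sum, Matrix.smul_apply, smul_eq_mul]
  exact Finset.sum_congr rfl fun i _ => Finset.sum_congr rfl fun j _ => by ring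

theorem quadForm_le_lamMax {n : ℕ} (A : Matrix (Fin n) (Fin n) ℝ) {ξ : En n} (hξ : ‖ξ‖ = 1) :
    quadForm A ξ ≤ lamMax A := by
  refine le_csSup ⟨∑ i, ∑ j, |A i j|, ?_⟩ ⟨ξ, hξ, rfl⟩
  rintro r ⟨η, hη, rfl⟩
  have hle (i : Fin n) : |η i| ≤ 1 := by
    simpa [hη] using PiLp.norm_apply_le η i
  refine Finset.sum_le_sum fun i _ => Finset.sum_le_sum fun j _ => ?_
  calc η i * A i j * η j ≤ |η i * A i j * η j| := le_abs_self _
    _ = |η i| * |A i j| * |η j| := by rw [abs_mul, abs_mul]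
    _ ≤ 1 * |A i j| * 1 := by gcongr <;> exact hle _
    _ = |A i j| := by ring

theorem lamMax_le {n : ℕ} (hn : 0 < n) {A : Matrix (Fin n) (Fin n) ℝ} {c : ℝ}
    (h : ∀ ξ : En n, ‖ξ‖ = 1 → quadForm A ξ ≤ c) : lamMax A ≤ c := by
  refine csSup_le ⟨_, EuclideanSpace.single ⟨0, hn⟩ 1, by simp, rfl⟩ ?_
  rintro r ⟨ξ, hξ, rfl⟩
  exact h ξ hξ

theorem quadForm_Mmat {n : ℕ} {μm μp μ : ℝ} (hm : μm < μ) (hp : μ < μp) (w m ξ : En n)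
    (σ : Matrix (Fin n) (Fin n) ℝ) :
    quadForm (Mmat μm μp μ w m σ) ξ =
      μp / (μp - μm) * ((∑ i, ξ i * m i - μm * ∑ i, ξ i * w i) ^ 2 / (μ - μm)) +
      μm / (μp - μm) * ((∑ i, ξ i * m i - μp * ∑ i, ξ i * w i) ^ 2 / (μp - μ)) -
      quadForm σ ξ := by
  simp only [Mmat, quadForm_sub, quadForm_smul, quadForm_add, quadForm_op]
  have h₁ : μp - μm ≠ 0 := by linarith
  have h₂ : μ - μm ≠ 0 := by linarith
  have h₃ : μp - μ ≠ 0 := by linarith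
  field_simp
  ring

/-- The function `Q(z) = λ_max(M(z))` is convex on
`Z₀ = {z ∈ Z : μ₋ < μ < μ₊}`. -/
theorem Q_convex (n : ℕ) (hn : 2 ≤ n) (μm μp : ℝ) (hμm : 0 < μm) (hμ : μm < μp) :
    ConvexOn ℝ {z : Zsp n | z.1 ∈ Set.Ioo μm μp} (fun z : Zsp n => QZ μm μp z) := by
  have hconv : Convex ℝ {z : Zsp n | z.1 ∈ Set.Ioo μm μp} :=
    (convex_Ioo μm μp).linear_preimage (LinearMap.fst ℝ ℝ (En n × En n × ↥(S0 n) × ℝ))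
  refine ⟨hconv, ?_⟩
  rintro ⟨μ₁, w₁, m₁, σ₁, q₁⟩ hz₁ ⟨μ₂, w₂, m₂, σ₂, q₂⟩ hz₂ t s ht hs hts
  have hz := hconv hz₁ hz₂ ht hs hts
  obtain ⟨hm₁, hp₁⟩ : μm < μ₁ ∧ μ₁ < μp := hz₁
  obtain ⟨hm₂, hp₂⟩ : μm < μ₂ ∧ μ₂ < μp := hz₂
  obtain ⟨hm, hp⟩ : μm < t * μ₁ + s * μ₂ ∧ t * μ₁ + s * μ₂ < μp := hz
  refine lamMax_le (by omega) fun ξ hξ => ?_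
  refine le_trans ?_ (add_le_add
    (mul_le_mul_of_nonneg_left (quadForm_le_lamMax (Mmat μm μp μ₁ w₁ m₁ σ₁) hξ) ht)
    (mul_le_mul_of_nonneg_left (quadForm_le_lamMax (Mmat μm μp μ₂ w₂ m₂ σ₂) hξ) hs))
  change quadForm (Mmat μm μp (t * μ₁ + s * μ₂) (t • w₁ + s • w₂) (t • m₁ + s • m₂)
    (t • (σ₁ : Matrix (Fin n) (Fin n) ℝ) + s • (σ₂ : Matrix (Fin n) (Fin n) ℝ))) ξ ≤ _
  have hsum (u v : En n) : ∑ i, ξ i * (t • u + s • v) i =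
      t * ∑ i, ξ i * u i + s * ∑ i, ξ i * v i := by
    simp only [Finset.mul_sum, ← Finset.sum_add_distrib, PiLp.add_apply, PiLp.smul_apply,
      smul_eq_mul]
    exact Finset.sum_congr rfl fun i _ => by ring
  rw [quadForm_Mmat hm hp, quadForm_Mmat hm₁ hp₁, quadForm_Mmat hm₂ hp₂, hsum, hsum,
    quadForm_add, quadForm_smul, quadForm_smul]
  set a₁ := ∑ i, ξ i * w₁ i
  set a₂ := ∑ i, ξ i * w₂ i
  set b₁ := ∑ i, ξ i * m₁ i
  set b₂ := ∑ i, ξ i * m₂ i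
  have eX (c : ℝ) : t * b₁ + s * b₂ - c * (t * a₁ + s * a₂) =
      t * (b₁ - c * a₁) + s * (b₂ - c * a₂) := by ring
  have eYm : t * μ₁ + s * μ₂ - μm = t * (μ₁ - μm) + s * (μ₂ - μm) := by
    linear_combination μm * hts
  have eYp : μp - (t * μ₁ + s * μ₂) = t * (μp - μ₁) + s * (μp - μ₂) := by
    linear_combination -μp * hts
  have hYm := sub_pos.2 hm
  have hYp := sub_pos.2 hp
  rw [eYm] at hYm
  rw [eYp] at hYp
  rw [eX, eX, eYm, eYp]
  have hd : 0 < μp - μm := sub_pos.2 hμ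
  have km := mul_le_mul_of_nonneg_left
    (sq_div_convex_comb_le (x₁ := b₁ - μm * a₁) (x₂ := b₂ - μm * a₂) ht hs
      (sub_pos.2 hm₁) (sub_pos.2 hm₂) hYm) (div_nonneg (hμm.trans hμ).le hd.le)
  have kp := mul_le_mul_of_nonneg_left
    (sq_div_convex_comb_le (x₁ := b₁ - μp * a₁) (x₂ := b₂ - μp * a₂) ht hs
      (sub_pos.2 hp₁) (sub_pos.2 hp₂) hYp) (div_nonneg hμm.le hd.le)
  linear_combination km + kp
end
end

section
/- For every pair (w̄, σ̄) ∈ ℝⁿ × S₀ with w̄ ≠ 0, there exists q̄ ∈ ℝ such that for every λ ∈ ℝ with λ ≠ 0, the vector z̄ = (0, w̄, λ·w̄, σ̄, q̄) belongs to the wave cone Λ. -/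
noncomputable section

open Matrix

/-- A symmetric operator compressed to the orthogonal complement of a line has an eigenvector. -/
theorem LinearMap.IsSymmetric.exists_eigenvector_mod_span_singleton {E : Type*}
    [NormedAddCommGroup E] [InnerProductSpace ℝ E] [FiniteDimensional ℝ E] {T : E →ₗ[ℝ] E}
    (hT : T.IsSymmetric) (hE : 2 ≤ Module.finrank ℝ E) (w : E) :
    ∃ (v : E) (a t : ℝ), v ≠ 0 ∧ inner ℝ w v = 0 ∧ T v = a • v + t • w := by
  let W : Submodule ℝ E := (ℝ ∙ w)ᗮ
  have : Nontrivial W := by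
    apply Module.nontrivial_of_finrank_pos (R := ℝ)
    have h₁ := (ℝ ∙ w).finrank_add_finrank_orthogonal
    have h₂ := finrank_span_le_card (R := ℝ) ({w} : Set E)
    simp only [Set.toFinset_singleton, Finset.card_singleton] at h₂
    change 0 < Module.finrank ℝ (ℝ ∙ w)ᗮ
    omega
  let S : W →ₗ[ℝ] W := W.orthogonalProjectionOnto.toLinearMap ∘ₗ T ∘ₗ W.subtype
  have hS : S.IsSymmetric := fun x y => by
    simp only [S, LinearMap.comp_apply, ContinuousLinearMap.coe_coe, Submodule.subtype_apply,
      Submodule.inner_orthogonalProjectionOnto_eq_of_mem_right,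
      Submodule.inner_orthogonalProjectionOnto_eq_of_mem_left]
    exact hT x y
  obtain ⟨v, hv⟩ := hS.hasEigenvalue_iSup_of_finiteDimensional.exists_hasEigenvector
  set a : ℝ := ⨆ x : {x : W // x ≠ 0}, RCLike.re (inner ℝ (S x) (x : W)) / ‖(x : W)‖ ^ 2
  have hSv : W.starProjection (T v) = a • (v : E) := congrArg Subtype.val hv.apply_eq_smul
  have hmem : T v - a • (v : E) ∈ ℝ ∙ w := by
    rw [← (ℝ ∙ w).orthogonal_orthogonal, ← hSv]
    exact W.sub_starProjection_mem_orthogonal (T v)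
  obtain ⟨t, ht⟩ := Submodule.mem_span_singleton.mp hmem
  refine ⟨v, a, t, fun h => hv.2 (Subtype.ext h),
    Submodule.mem_orthogonal_singleton_iff_inner_right.mp v.2, ?_⟩
  rw [ht]
  abel

/-- For every `(w̄, σ̄) ∈ ℝⁿ × S₀` with `w̄ ≠ 0` there exists `q̄ ∈ ℝ`
such that for every `λ ≠ 0` the vector `z̄ = (0, w̄, λ·w̄, σ̄, q̄)` belongs to the wave cone. -/
theorem euler_directions_in_cone (n : ℕ) (hn : 2 ≤ n) (μm μp : ℝ) (hμm : 0 < μm)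
    (hμ : μm < μp) (wb : En n) (σb : ↥(S0 n)) (hw : wb ≠ 0) :
    ∃ qb : ℝ, ∀ lam : ℝ, lam ≠ 0 →
      (((0 : ℝ), wb, lam • wb, σb, qb) : Zsp n) ∈ Lambda n := by
  obtain ⟨v, a, t, hv, hwv, hσv⟩ :=
    (Matrix.isSymmetric_toEuclideanLin_iff.mpr
      (show (σb : Matrix (Fin n) (Fin n) ℝ).IsHermitian from
        σb.2.1)).exists_eigenvector_mod_span_singleton (by simpa using hn) wb
  have hsum : ∑ j, wb j * v j = 0 := by
    simpa [PiLp.inner_apply, mul_comm] using hwv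
  refine ⟨-a, fun lam hlam => ⟨fun h => smul_ne_zero hlam hw h.2, v, -t / lam,
    fun h => hv (WithLp.ofLp_injective 2 h.1), ?_, ?_, hsum⟩⟩
  · have h : (σb : Matrix (Fin n) (Fin n) ℝ) *ᵥ v.ofLp = a • v.ofLp + t • wb.ofLp :=
      congrArg WithLp.ofLp hσv
    ext i
    simp only [Matrix.add_mulVec, Matrix.smul_mulVec, Matrix.one_mulVec, h, Pi.add_apply,
      Pi.smul_apply, PiLp.smul_apply, smul_eq_mul, Pi.zero_apply]
    field_simp
    ring
  · simp [mul_assoc, ← Finset.mul_sum, hsum]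
end
end

section
/- For every z ∈ Z with μ ∈ (μ₋, μ₊), the Muskat direction z̃(z) belongs to the wave cone Λ. -/
noncomputable section

open Matrix

/-- The `w̃` component of the Muskat direction. -/
def tilw {n : ℕ} (μm μp μ : ℝ) (w m : En n) : En n :=
  (((μp - μ) * (μ - μm))⁻¹) • (m - μ • w)

/-- The `m̃` component of the Muskat direction. -/
def tilm {n : ℕ} (μm μp μ : ℝ) (w m : En n) : En n :=
  w + (μp + μm - μ) • tilw μm μp μ w m

/-- The `q̃` component of the Muskat direction. -/
def tilq {n : ℕ} (μm μp μ : ℝ) (w m : En n) : ℝ :=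
  (1 / (n : ℝ)) * Matrix.trace
    (op (tilm μm μp μ w m) (tilm μm μp μ w m) - (μp * μm) • op (tilw μm μp μ w m) (tilw μm μp μ w m))

/-- The `σ̃` component of the Muskat direction (as a matrix). -/
def stil {n : ℕ} (μm μp μ : ℝ) (w m : En n) : Matrix (Fin n) (Fin n) ℝ :=
  op (tilm μm μp μ w m) (tilm μm μp μ w m) - (μp * μm) • op (tilw μm μp μ w m) (tilw μm μp μ w m)
    - tilq μm μp μ w m • (1 : Matrix (Fin n) (Fin n) ℝ)

theorem op_eq_vecMulVec {n : ℕ} (a b : En n) :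
    op a b = Matrix.vecMulVec (fun i => a i) (fun j => b j) := rfl

theorem isSymm_op_self {n : ℕ} (a : En n) : (op a a).IsSymm :=
  Matrix.IsSymm.ext fun i j => mul_comm (a j) (a i)

theorem stil_mem_S0 {n : ℕ} (hn : n ≠ 0) (μm μp μ : ℝ) (w m : En n) :
    stil μm μp μ w m ∈ S0 n := by
  refine ⟨((isSymm_op_self _).sub ((isSymm_op_self _).smul _)).sub (Matrix.isSymm_one.smul _), ?_⟩
  have hn' : (n : ℝ) ≠ 0 := Nat.cast_ne_zero.mpr hn
  rw [stil, Matrix.trace_sub, Matrix.trace_smul, Matrix.trace_one, Fintype.card_fin, tilq,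
    smul_eq_mul]
  field_simp
  ring

theorem stil_add_tilq_smul_one {n : ℕ} (μm μp μ : ℝ) (w m : En n) :
    stil μm μp μ w m + tilq μm μp μ w m • (1 : Matrix (Fin n) (Fin n) ℝ) =
      op (tilm μm μp μ w m) (tilm μm μp μ w m) -
        (μp * μm) • op (tilw μm μp μ w m) (tilw μm μp μ w m) :=
  sub_add_cancel _ _

/-- For every `z ∈ Z` with `μ ∈ (μ₋, μ₊)`, the Muskat direction `z̃(z)`
(whose `σ̃`-component is a symmetric trace-free matrix) belongs to the wave cone `Λ`. -/
theorem muskat_direction_in_cone (n : ℕ) (hn : 2 ≤ n) (μm μp : ℝ) (hμm : 0 < μm)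
    (hμ : μm < μp) (z : Zsp n) (hz : z.1 ∈ Set.Ioo μm μp) :
    ∃ σt : ↥(S0 n), (σt : Matrix (Fin n) (Fin n) ℝ) = stil μm μp z.1 z.2.1 z.2.2.1 ∧
      (((1 : ℝ), tilw μm μp z.1 z.2.1 z.2.2.1, tilm μm μp z.1 z.2.1 z.2.2.1, σt,
        tilq μm μp z.1 z.2.1 z.2.2.1) : Zsp n) ∈ Lambda n := by
  obtain ⟨μ, w, m, σ, q⟩ := z
  have : Nontrivial (Fin n) := Fin.nontrivial_iff_two_le.mpr hn
  refine ⟨⟨_, stil_mem_S0 (by omega) μm μp μ w m⟩, rfl, fun h => one_ne_zero h.1, ?_⟩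
  obtain ⟨ξ, hξ, hw⟩ :=
    exists_ne_zero_dotProduct_eq_zero (fun i => tilw μm μp μ w m i)
  rw [dotProduct_comm] at hw
  refine ⟨ξ, -((fun i => tilm μm μp μ w m i) ⬝ᵥ ξ), fun h => hξ h.1, ?_, ?_, hw⟩
  · dsimp only
    rw [stil_add_tilq_smul_one, Matrix.sub_mulVec, Matrix.smul_mulVec, op_eq_vecMulVec,
      op_eq_vecMulVec, Matrix.vecMulVec_mulVec, Matrix.vecMulVec_mulVec, hw]
    ext i
    simp [mul_comm]
  · simp [dotProduct]
end
end

section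
/- Let z ∈ Z with μ ∈ (μ₋, μ₊) and let t ∈ (μ₋ − μ, μ₊ − μ); set z_t = z + t·z̃(z), whose first component μ + t lies in (μ₋, μ₊). Then: z̃(z_t) = z̃(z); T₊(z_t) = T₊(z) and T₋(z_t) = T₋(z); and the trace-free parts of M agree, i.e. M(z_t) − (tr M(z_t)/n)·Id = M(z) − (tr M(z)/n)·Id. -/
noncomputable section

open Matrix

/-- The trace-free part `A − (tr A / n)·Id` of a matrix. -/
def traceless {n : ℕ} (A : Matrix (Fin n) (Fin n) ℝ) : Matrix (Fin n) (Fin n) ℝ :=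
  A - (Matrix.trace A / (n : ℝ)) • (1 : Matrix (Fin n) (Fin n) ℝ)

section MuskatCoordinates

variable {n : ℕ} {μm μp μ : ℝ}

lemma w_eq_tilm_sub (w m : En n) :
    w = tilm μm μp μ w m - (μp + μm - μ) • tilw μm μp μ w m := by
  simp [tilm]

lemma m_eq_smul_tilm_sub (h : (μp - μ) * (μ - μm) ≠ 0) (w m : En n) :
    m = μ • tilm μm μp μ w m - (μm * μp) • tilw μm μp μ w m := by
  have hw : ((μp - μ) * (μ - μm)) • tilw μm μp μ w m = m - μ • w := by
    rw [tilw, smul_inv_smul₀ h]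
  rw [tilm]
  linear_combination (norm := module) -hw

/-- A state given by `w = b - (μ₊ + μ₋ - μ) a` and `m = μ b - μ₋ μ₊ a` has `w̃ = a`. -/
lemma tilw_of_coordinates (h : (μp - μ) * (μ - μm) ≠ 0) (a b : En n) :
    tilw μm μp μ (b - (μp + μm - μ) • a) (μ • b - (μm * μp) • a) = a := by
  rw [tilw, inv_smul_eq_iff₀ h]
  module

lemma tilm_of_coordinates (h : (μp - μ) * (μ - μm) ≠ 0) (a b : En n) :
    tilm μm μp μ (b - (μp + μm - μ) • a) (μ • b - (μm * μp) • a) = b := by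
  simp [tilm, tilw_of_coordinates h]

lemma Tp_of_coordinates (h : μ - μm ≠ 0) (a b : En n) :
    Tp μm μp μ (b - (μp + μm - μ) • a) (μ • b - (μm * μp) • a) =
      μp / n * ‖b - μm • a‖ ^ 2 := by
  have key : μ • b - (μm * μp) • a - μm • (b - (μp + μm - μ) • a) =
      (μ - μm) • (b - μm • a) := by module
  rw [Tp, key, norm_smul, mul_pow, Real.norm_eq_abs, sq_abs]
  field_simp

lemma Tm_of_coordinates (h : μ - μp ≠ 0) (a b : En n) :
    Tm μm μp μ (b - (μp + μm - μ) • a) (μ • b - (μm * μp) • a) =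
      μm / n * ‖b - μp • a‖ ^ 2 := by
  have key : μ • b - (μm * μp) • a - μp • (b - (μp + μm - μ) • a) =
      (μ - μp) • (b - μp • a) := by module
  rw [Tm, key, norm_smul, mul_pow, Real.norm_eq_abs, sq_abs]
  field_simp

lemma Mmat_of_coordinates (h : (μp - μ) * (μ - μm) ≠ 0) (a b : En n)
    (σ : Matrix (Fin n) (Fin n) ℝ) :
    Mmat μm μp μ (b - (μp + μm - μ) • a) (μ • b - (μm * μp) • a) σ =
      μ • op b b - (μm * μp) • (op a b + op b a) + (μm * μp * (μp + μm - μ)) • op a a - σ := by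
  rw [Mmat, sub_left_inj, inv_smul_eq_iff₀ h]
  ext i j
  simp only [op, Matrix.add_apply, Matrix.sub_apply, Matrix.smul_apply, smul_eq_mul,
    PiLp.sub_apply, PiLp.smul_apply]
  ring

lemma traceless_add_smul_one (hn : n ≠ 0) (A : Matrix (Fin n) (Fin n) ℝ) (c : ℝ) :
    traceless (A + c • (1 : Matrix (Fin n) (Fin n) ℝ)) = traceless A := by
  have hn' : (n : ℝ) ≠ 0 := Nat.cast_ne_zero.mpr hn
  have key : (A + c • (1 : Matrix (Fin n) (Fin n) ℝ)).trace / n = A.trace / n + c := by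
    simp [Matrix.trace_add, Matrix.trace_smul, Matrix.trace_one]
    field_simp
  rw [traceless, traceless, key]
  module

end MuskatCoordinates

/-- Along the Muskat line `z_t = z + t·z̃(z)`, `t ∈ (μ₋ − μ, μ₊ − μ)`:
the first component stays in `(μ₋, μ₊)`, the Muskat direction itself, `T₊`, `T₋`
and the trace-free part of `M` are all invariant. -/
theorem muskat_line_invariances (n : ℕ) (hn : 2 ≤ n) (μm μp : ℝ) (hμm : 0 < μm)
    (hμ : μm < μp) (μ : ℝ) (hμ0 : μ ∈ Set.Ioo μm μp) (w m : En n) (σ : ↥(S0 n)) (q : ℝ)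
    (t : ℝ) (ht : t ∈ Set.Ioo (μm - μ) (μp - μ)) :
    μ + t ∈ Set.Ioo μm μp ∧
    tilw μm μp (μ + t) (w + t • tilw μm μp μ w m) (m + t • tilm μm μp μ w m) =
      tilw μm μp μ w m ∧
    tilm μm μp (μ + t) (w + t • tilw μm μp μ w m) (m + t • tilm μm μp μ w m) =
      tilm μm μp μ w m ∧
    tilq μm μp (μ + t) (w + t • tilw μm μp μ w m) (m + t • tilm μm μp μ w m) =
      tilq μm μp μ w m ∧
    stil μm μp (μ + t) (w + t • tilw μm μp μ w m) (m + t • tilm μm μp μ w m) =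
      stil μm μp μ w m ∧
    Tp μm μp (μ + t) (w + t • tilw μm μp μ w m) (m + t • tilm μm μp μ w m) =
      Tp μm μp μ w m ∧
    Tm μm μp (μ + t) (w + t • tilw μm μp μ w m) (m + t • tilm μm μp μ w m) =
      Tm μm μp μ w m ∧
    traceless (Mmat μm μp (μ + t) (w + t • tilw μm μp μ w m) (m + t • tilm μm μp μ w m)
        ((σ : Matrix (Fin n) (Fin n) ℝ) + t • stil μm μp μ w m)) =
      traceless (Mmat μm μp μ w m (σ : Matrix (Fin n) (Fin n) ℝ)) := by
  obtain ⟨h₁, h₂⟩ := hμ0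
  obtain ⟨h₃, h₄⟩ := ht
  have hD : (μp - μ) * (μ - μm) ≠ 0 := (mul_pos (by linarith) (by linarith)).ne'
  have hDt : (μp - (μ + t)) * (μ + t - μm) ≠ 0 := (mul_pos (by linarith) (by linarith)).ne'
  have hw := w_eq_tilm_sub (μm := μm) (μp := μp) (μ := μ) w m
  have hm := m_eq_smul_tilm_sub hD w m
  have hq : tilq μm μp μ w m = (1 / (n : ℝ)) * Matrix.trace
      (op (tilm μm μp μ w m) (tilm μm μp μ w m) -
        (μp * μm) • op (tilw μm μp μ w m) (tilw μm μp μ w m)) := rfl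
  have hs : stil μm μp μ w m = op (tilm μm μp μ w m) (tilm μm μp μ w m) -
      (μp * μm) • op (tilw μm μp μ w m) (tilw μm μp μ w m) -
        tilq μm μp μ w m • (1 : Matrix (Fin n) (Fin n) ℝ) := rfl
  generalize tilq μm μp μ w m = r at *
  generalize stil μm μp μ w m = s at *
  generalize tilw μm μp μ w m = a at *
  generalize tilm μm μp μ w m = b at *
  subst hw hm
  have hwt : b - (μp + μm - μ) • a + t • a = b - (μp + μm - (μ + t)) • a := by module
  have hmt : μ • b - (μm * μp) • a + t • b = (μ + t) • b - (μm * μp) • a := by module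
  rw [hwt, hmt]
  have hqt : tilq μm μp (μ + t) (b - (μp + μm - (μ + t)) • a)
      ((μ + t) • b - (μm * μp) • a) = r := by
    rw [tilq, tilw_of_coordinates hDt, tilm_of_coordinates hDt, hq]
  refine ⟨⟨by linarith, by linarith⟩, tilw_of_coordinates hDt a b, tilm_of_coordinates hDt a b,
    hqt, ?_, ?_, ?_, ?_⟩
  · rw [stil, hqt, tilw_of_coordinates hDt, tilm_of_coordinates hDt, hs]
  · rw [Tp_of_coordinates (right_ne_zero_of_mul hDt), Tp_of_coordinates (right_ne_zero_of_mul hD)]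
  · rw [Tm_of_coordinates (by linarith), Tm_of_coordinates (by linarith)]
  · rw [Mmat_of_coordinates hDt, Mmat_of_coordinates hD,
      ← traceless_add_smul_one (by lia) _ (-(t * r)), hs]
    congr 1
    module
end
end

section
/- For any z₁ = (μ₁, w₁, m₁, σ₁, q₁) and z₂ = (μ₂, w₂, m₂, σ₂, q₂) in K with (μ₁, w₁, m₁, σ₁) ≠ (μ₂, w₂, m₂, σ₂), the vector z₂ − z₁ + (0, 0, 0, 0, q₁ − q₂) belongs to the wave cone Λ. -/
noncomputable section

open Matrix

lemma op_mulVec {n : ℕ} (w m : En n) (ξ : Fin n → ℝ) :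
    op w m *ᵥ ξ = (∑ j, m j * ξ j) • (fun i => w i) := by
  ext i
  simp only [op, mulVec, dotProduct, Pi.smul_apply, smul_eq_mul, Finset.sum_mul]
  exact Finset.sum_congr rfl fun j _ => by ring

/-- For `z₁, z₂ ∈ K` with `(μ₁,w₁,m₁,σ₁) ≠ (μ₂,w₂,m₂,σ₂)`, the vector
`z₂ − z₁ + (0,0,0,0,q₁ − q₂)` belongs to the wave cone `Λ`. -/
theorem K_differences_in_cone (n : ℕ) (hn : 2 ≤ n) (μm μp : ℝ) (hμm : 0 < μm)
    (hμ : μm < μp) (e : ℝ) (he : 0 < e) (z1 z2 : Zsp n)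
    (hz1 : z1 ∈ Kset n μm μp e) (hz2 : z2 ∈ Kset n μm μp e) (hne : pz z1 ≠ pz z2) :
    z2 - z1 + (((0 : ℝ), (0 : En n), (0 : En n), (0 : ↥(S0 n)),
      z1.2.2.2.2 - z2.2.2.2.2) : Zsp n) ∈ Lambda n := by
  obtain ⟨μ₁, w₁, m₁, σ₁, q₁⟩ := z1
  obtain ⟨μ₂, w₂, m₂, σ₂, q₂⟩ := z2
  obtain ⟨hμ₁, hm₁, hσ₁⟩ := hz1
  obtain ⟨-, hm₂, hσ₂⟩ := hz2
  dsimp only at hμ₁ hm₁ hσ₁ hm₂ hσ₂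
  have hpos : μ₁ ≠ 0 := by rcases hμ₁ with rfl | rfl <;> linarith
  have hσ : (σ₂ : Matrix (Fin n) (Fin n) ℝ) - σ₁ = μ₂ • op w₂ w₂ - μ₁ • op w₁ w₁ := by
    rw [sub_eq_sub_iff_add_eq_add, ← sub_eq_sub_iff_add_eq_add.mp (hσ₁.trans hσ₂.symm), add_comm]
  subst hm₁ hm₂
  refine ⟨?_, ?_⟩
  · rintro ⟨h₁, h₂⟩
    simp only [Prod.fst_add, Prod.snd_add, Prod.fst_sub, Prod.snd_sub, add_zero,
      sub_eq_zero] at h₁ h₂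
    subst h₁
    obtain rfl := smul_right_injective _ hpos h₂
    have : σ₂ = σ₁ := Subtype.ext (sub_eq_zero.mp (by simpa using hσ))
    exact hne (by simp [pz, this])
  · have : Nontrivial (Fin n) := Fin.nontrivial_iff_two_le.mpr hn
    obtain ⟨ξ, hξ0, hξ⟩ := exists_ne_zero_dotProduct_eq_zero (fun j => w₂ j - w₁ j)
    have hw : ∑ j, w₂ j * ξ j = ∑ j, w₁ j * ξ j := by
      simpa [dotProduct, mul_sub, mul_comm, sub_eq_zero] using hξ
    refine ⟨ξ, -∑ j, w₁ j * ξ j, fun h => hξ0 h.1, ?_, ?_, ?_⟩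
    · simp only [Prod.fst_add, Prod.snd_add, Prod.fst_sub, Prod.snd_sub, add_zero,
        AddSubgroupClass.coe_sub, hσ, sub_add_sub_cancel, sub_self, zero_smul, sub_mulVec,
        smul_mulVec, op_mulVec, hw]
      ext i
      simp
      ring
    · simp [sub_mul, mul_assoc, ← Finset.mul_sum, hw]
      ring
    · simp [sub_mul, hw]
end
end

section
/- There exists a constant C > 0, depending only on e, μ₋, μ₊ and n, such that for every z = (μ, w, m, σ, q) ∈ U one has |μ| + |w| + |m| + |σ| ≤ C, where |σ| denotes the Frobenius norm. In particular the projection π(U) has compact closure. -/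
noncomputable section

open Matrix

/-- The Frobenius norm of a matrix. -/
def frob {n : ℕ} (σ : Matrix (Fin n) (Fin n) ℝ) : ℝ :=
  Real.sqrt (∑ i, ∑ j, (σ i j) ^ 2)

open Finset in
lemma quadratic_form_le_sum_abs {n : ℕ} (A : Matrix (Fin n) (Fin n) ℝ) {ξ : En n}
    (hξ : ‖ξ‖ = 1) : ∑ i, ∑ j, ξ i * A i j * ξ j ≤ ∑ i, ∑ j, |A i j| := by
  have h : ∀ i, |ξ i| ≤ 1 := fun i => by
    simpa [hξ] using PiLp.norm_apply_le ξ i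
  refine sum_le_sum fun i _ => sum_le_sum fun j _ => (le_abs_self _).trans ?_
  rw [abs_mul, abs_mul]
  calc |ξ i| * |A i j| * |ξ j| ≤ 1 * |A i j| * 1 := by gcongr <;> exact h _
    _ = |A i j| := by ring

lemma quadratic_form_le_lamMax {n : ℕ} (A : Matrix (Fin n) (Fin n) ℝ) (ξ : En n) :
    ∑ i, ∑ j, ξ i * A i j * ξ j ≤ lamMax A * ‖ξ‖ ^ 2 := by
  rcases eq_or_ne ξ 0 with rfl | hξ
  · simp
  have hpos : 0 < ‖ξ‖ := norm_pos_iff.mpr hξ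
  have hunit : ∑ i, ∑ j, (‖ξ‖⁻¹ • ξ) i * A i j * (‖ξ‖⁻¹ • ξ) j ≤ lamMax A := by
    refine le_csSup ⟨∑ i, ∑ j, |A i j|, ?_⟩ ⟨‖ξ‖⁻¹ • ξ, norm_smul_inv_norm hξ, rfl⟩
    rintro _ ⟨η, hη, rfl⟩
    exact quadratic_form_le_sum_abs A hη
  have hscale : ∑ i, ∑ j, ξ i * A i j * ξ j =
      (∑ i, ∑ j, (‖ξ‖⁻¹ • ξ) i * A i j * (‖ξ‖⁻¹ • ξ) j) * ‖ξ‖ ^ 2 := by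
    simp only [Finset.sum_mul, PiLp.smul_apply, smul_eq_mul]
    refine Finset.sum_congr rfl fun i _ => Finset.sum_congr rfl fun j _ => ?_
    field_simp
  rw [hscale]
  gcongr

lemma Mmat_add_eq {n : ℕ} {μm μp μ : ℝ} (hm : μm < μ) (hp : μ < μp) (w m : En n)
    (σ : Matrix (Fin n) (Fin n) ℝ) (i j : Fin n) :
    Mmat μm μp μ w m σ i j + σ i j =
      μp / ((μ - μm) * (μp - μm)) * ((m i - μm * w i) * (m j - μm * w j)) +
      μm / ((μp - μ) * (μp - μm)) * ((m i - μp * w i) * (m j - μp * w j)) := by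
  have h₁ : μ - μm ≠ 0 := (sub_pos.mpr hm).ne'
  have h₂ : μp - μ ≠ 0 := (sub_pos.mpr hp).ne'
  have h₃ : μp - μm ≠ 0 := (sub_pos.mpr (hm.trans hp)).ne'
  simp only [Mmat, op, Matrix.sub_apply, Matrix.smul_apply, Matrix.add_apply, smul_eq_mul,
    sub_add_cancel]
  field_simp
  ring

lemma quadratic_form_outer {n : ℕ} (v ξ : Fin n → ℝ) :
    ∑ i, ∑ j, ξ i * (v i * v j) * ξ j = (∑ i, ξ i * v i) ^ 2 := by
  rw [sq, Finset.sum_mul_sum]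
  exact Finset.sum_congr rfl fun i _ => Finset.sum_congr rfl fun j _ => by ring

lemma neg_lamMax_Mmat_le_quadratic_form {n : ℕ} {μm μp μ : ℝ} (h0 : 0 < μm) (hm : μm < μ)
    (hp : μ < μp) (w m : En n) (σ : Matrix (Fin n) (Fin n) ℝ) (ξ : En n) :
    -(lamMax (Mmat μm μp μ w m σ) * ‖ξ‖ ^ 2) ≤ ∑ i, ∑ j, ξ i * σ i j * ξ j := by
  have h := quadratic_form_le_lamMax (Mmat μm μp μ w m σ) ξ
  have h₁ := sub_pos.mpr hm
  have h₂ := sub_pos.mpr hp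
  have h₃ := sub_pos.mpr (hm.trans hp)
  have h₄ := h0.trans (hm.trans hp)
  have hsum : ∑ i, ∑ j, ξ i * Mmat μm μp μ w m σ i j * ξ j + ∑ i, ∑ j, ξ i * σ i j * ξ j =
      μp / ((μ - μm) * (μp - μm)) * (∑ i, ξ i * (m i - μm * w i)) ^ 2 +
      μm / ((μp - μ) * (μp - μm)) * (∑ i, ξ i * (m i - μp * w i)) ^ 2 := by
    rw [← quadratic_form_outer, ← quadratic_form_outer]
    simp only [Finset.mul_sum, ← Finset.sum_add_distrib]
    refine Finset.sum_congr rfl fun i _ => Finset.sum_congr rfl fun j _ => ?_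
    linear_combination (ξ i * ξ j) * Mmat_add_eq hm hp w m σ i j
  have hnonneg : 0 ≤ μp / ((μ - μm) * (μp - μm)) * (∑ i, ξ i * (m i - μm * w i)) ^ 2 +
      μm / ((μp - μ) * (μp - μm)) * (∑ i, ξ i * (m i - μp * w i)) ^ 2 := by positivity
  linarith

lemma quadratic_form_single_add {n : ℕ} (A : Matrix (Fin n) (Fin n) ℝ) (i j : Fin n) (s : ℝ) :
    ∑ k, ∑ l, (EuclideanSpace.single i (1 : ℝ) + s • EuclideanSpace.single j (1 : ℝ)) k * A k l *
      (EuclideanSpace.single i (1 : ℝ) + s • EuclideanSpace.single j (1 : ℝ)) l =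
      A i i + s * (A i j + A j i) + s ^ 2 * A j j := by
  simp [add_mul, mul_add, Finset.sum_add_distrib]
  ring

lemma norm_single_add_sq_le {n : ℕ} (i j : Fin n) {s : ℝ} (hs : |s| ≤ 1) :
    ‖(EuclideanSpace.single i (1 : ℝ) + s • EuclideanSpace.single j (1 : ℝ) : En n)‖ ^ 2 ≤ 4 := by
  have h := norm_add_le (EuclideanSpace.single i (1 : ℝ) : En n)
    (s • EuclideanSpace.single j (1 : ℝ))
  rw [norm_smul, PiLp.norm_single, PiLp.norm_single, norm_one,
    Real.norm_eq_abs] at h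
  nlinarith [norm_nonneg
    (EuclideanSpace.single i (1 : ℝ) + s • EuclideanSpace.single j (1 : ℝ) : En n)]

lemma abs_apply_le_of_quadratic_form_ge {n : ℕ} {e : ℝ} (he : 0 < e)
    {σ : Matrix (Fin n) (Fin n) ℝ} (hσ : σ ∈ S0 n)
    (h : ∀ ξ : En n, -(e * ‖ξ‖ ^ 2) ≤ ∑ i, ∑ j, ξ i * σ i j * ξ j) (i j : Fin n) :
    |σ i j| ≤ (n + 2) * e := by
  have hpm : ∀ i j (s : ℝ), |s| ≤ 1 →
      -(4 * e) ≤ σ i i + s * (σ i j + σ j i) + s ^ 2 * σ j j := fun i j s hs => by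
    have := h (EuclideanSpace.single i (1 : ℝ) + s • EuclideanSpace.single j (1 : ℝ))
    rw [quadratic_form_single_add] at this
    nlinarith [norm_single_add_sq_le i j hs]
  have hge : ∀ i, 0 ≤ σ i i + e := fun i => by
    have := hpm i i 1 (by simp)
    linarith
  have hle : ∀ i, σ i i ≤ n * e := fun i => by
    have hsum := Finset.single_le_sum (fun k _ => hge k) (Finset.mem_univ i)
    have htr : ∑ k, σ k k = 0 := hσ.2
    rw [Finset.sum_add_distrib, htr] at hsum
    simp at hsum
    linarith
  have hsymm : σ j i = σ i j := hσ.1.apply i j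
  have h₁ := hpm i j 1 (by simp)
  have h₂ := hpm i j (-1) (by simp)
  rw [hsymm] at h₁ h₂
  rw [abs_le]
  constructor <;> linarith [hle i, hle j]

lemma norm_le_of_mul_sq_div_sq_lt {n : ℕ} (hn : 0 < n) {c d e : ℝ} (hc : 0 < c) (hd : d ≠ 0)
    {v : En n} (h : c / n * ‖v‖ ^ 2 / d ^ 2 < e) : ‖v‖ ≤ √(e * n / c) * |d| := by
  have hn' : (0 : ℝ) < n := Nat.cast_pos.mpr hn
  have hd2 : 0 < d ^ 2 := by positivity
  have hv : ‖v‖ ^ 2 ≤ e * n / c * d ^ 2 := by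
    rw [div_lt_iff₀ hd2] at h
    rw [div_mul_eq_mul_div, le_div_iff₀ hc]
    rw [div_mul_eq_mul_div, div_lt_iff₀ hn'] at h
    linarith
  rw [← Real.sqrt_sq_eq_abs, ← Real.sqrt_mul' _ hd2.le]
  exact Real.le_sqrt_of_sq_le hv

lemma frob_le_of_abs_apply_le {n : ℕ} {A : Matrix (Fin n) (Fin n) ℝ} {c : ℝ} (hc : 0 ≤ c)
    (h : ∀ i j, |A i j| ≤ c) : frob A ≤ n * c := by
  refine Real.sqrt_le_iff.mpr ⟨by positivity, ?_⟩
  calc ∑ i, ∑ j, A i j ^ 2 ≤ ∑ _i : Fin n, ∑ _j : Fin n, c ^ 2 :=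
        Finset.sum_le_sum fun i _ => Finset.sum_le_sum fun j _ => sq_le_sq'
          (abs_le.mp (h i j)).1 (abs_le.mp (h i j)).2
    _ = (n * c) ^ 2 := by simp; ring

lemma abs_apply_le_frob {n : ℕ} (A : Matrix (Fin n) (Fin n) ℝ) (i j : Fin n) :
    |A i j| ≤ frob A := by
  refine Real.abs_le_sqrt ?_
  exact (Finset.single_le_sum (f := fun j => A i j ^ 2) (fun _ _ => sq_nonneg _)
    (Finset.mem_univ j)).trans
    (Finset.single_le_sum (f := fun i => ∑ j, A i j ^ 2)
      (fun _ _ => Finset.sum_nonneg fun _ _ => sq_nonneg _) (Finset.mem_univ i))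

lemma norm_w_m_le_of_mem_Uset {n : ℕ} (hn : 0 < n) {μm μp e : ℝ} (hμm : 0 < μm) (hμ : μm < μp)
    {z : Zsp n} (hz : z ∈ Uset n μm μp e) :
    ‖z.2.1‖ ≤ √(e * n / μp) + √(e * n / μm) ∧
      ‖z.2.2.1‖ ≤ μm * (√(e * n / μp) + √(e * n / μm)) + √(e * n / μp) * (μp - μm) := by
  obtain ⟨μ, w, m, σ, q⟩ := z
  obtain ⟨⟨hm, hp⟩, hTp, hTm, -⟩ := hz
  dsimp only [TpZ, TmZ, Tp, Tm] at hm hp hTp hTm ⊢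
  have ha := norm_le_of_mul_sq_div_sq_lt hn (hμm.trans hμ) (sub_pos.mpr hm).ne' hTp
  have hb := norm_le_of_mul_sq_div_sq_lt hn hμm (sub_neg.mpr hp).ne hTm
  rw [abs_of_pos (sub_pos.mpr hm)] at ha
  rw [abs_of_neg (sub_neg.mpr hp)] at hb
  have hΔ : 0 < μp - μm := sub_pos.mpr hμ
  have hsa := Real.sqrt_nonneg (e * n / μp)
  have hsb := Real.sqrt_nonneg (e * n / μm)
  have hw : ‖w‖ ≤ √(e * n / μp) + √(e * n / μm) := by
    have heq : (μp - μm) • w = (m - μm • w) - (m - μp • w) := by module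
    have hle := norm_sub_le (m - μm • w) (m - μp • w)
    rw [← heq, norm_smul, Real.norm_of_nonneg hΔ.le] at hle
    refine le_of_mul_le_mul_left ?_ hΔ
    nlinarith
  refine ⟨hw, ?_⟩
  have hle := norm_add_le (μm • w) (m - μm • w)
  rw [add_sub_cancel, norm_smul, Real.norm_of_nonneg hμm.le] at hle
  nlinarith

lemma abs_sigma_apply_le_of_mem_Uset {n : ℕ} {μm μp e : ℝ} (hμm : 0 < μm) (he : 0 < e)
    {z : Zsp n} (hz : z ∈ Uset n μm μp e) (i j : Fin n) :
    |(z.2.2.2.1 : Matrix (Fin n) (Fin n) ℝ) i j| ≤ (n + 2) * e := by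
  obtain ⟨⟨hm, hp⟩, -, -, hQ⟩ := hz
  refine abs_apply_le_of_quadratic_form_ge he z.2.2.2.1.2 (fun ξ => ?_) i j
  refine le_trans ?_ (neg_lamMax_Mmat_le_quadratic_form hμm hm hp z.2.1 z.2.2.1 _ ξ)
  rw [neg_le_neg_iff]
  exact mul_le_mul_of_nonneg_right hQ.le (sq_nonneg _)

lemma isCompact_S0_abs_apply_le (n : ℕ) (C : ℝ) :
    IsCompact {σ : S0 n | ∀ i j, |(σ : Matrix (Fin n) (Fin n) ℝ) i j| ≤ C} := by
  have hpi : IsCompact (Set.univ.pi fun _ : Fin n => Set.univ.pi fun _ : Fin n => Set.Icc (-C) C :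
      Set (Matrix (Fin n) (Fin n) ℝ)) :=
    isCompact_univ_pi fun _ => isCompact_univ_pi fun _ => isCompact_Icc
  have hclosed : IsClosed (S0 n : Set (Matrix (Fin n) (Fin n) ℝ)) :=
    (S0 n).closed_of_finiteDimensional
  have hset : {σ : S0 n | ∀ i j, |(σ : Matrix (Fin n) (Fin n) ℝ) i j| ≤ C} =
      Subtype.val ⁻¹' (Set.univ.pi fun _ => Set.univ.pi fun _ => Set.Icc (-C) C) := by
    ext σ
    exact ⟨fun h i _ j _ => abs_le.mp (h i j), fun h i j => abs_le.mpr (h i trivial j trivial)⟩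
  rw [hset]
  exact hclosed.isClosedEmbedding_subtypeVal.isCompact_preimage hpi

/-- There is a constant `C > 0` (depending only on `e, μ₋, μ₊, n`) bounding
`|μ| + |w| + |m| + |σ|` for all `z ∈ U`; in particular `closure (π(U))` is compact. -/
theorem U_bounded_and_proj_compact (n : ℕ) (hn : 2 ≤ n) (μm μp : ℝ) (hμm : 0 < μm)
    (hμ : μm < μp) (e : ℝ) (he : 0 < e) :
    (∃ C : ℝ, 0 < C ∧ ∀ z ∈ Uset n μm μp e,
      |z.1| + ‖z.2.1‖ + ‖z.2.2.1‖ + frob (z.2.2.2.1 : Matrix (Fin n) (Fin n) ℝ) ≤ C) ∧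
    IsCompact (closure (pz '' Uset n μm μp e)) := by
  have hbound : ∃ C : ℝ, 0 < C ∧ ∀ z ∈ Uset n μm μp e,
      |z.1| + ‖z.2.1‖ + ‖z.2.2.1‖ + frob (z.2.2.2.1 : Matrix (Fin n) (Fin n) ℝ) ≤ C := by
    have hμp := hμm.trans hμ
    have hΔ := sub_pos.mpr hμ
    refine ⟨μp + (√(e * n / μp) + √(e * n / μm)) +
      (μm * (√(e * n / μp) + √(e * n / μm)) + √(e * n / μp) * (μp - μm)) +
      n * ((n + 2) * e), by positivity, fun z hz => ?_⟩
    have hμz : |z.1| ≤ μp := by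
      rw [abs_of_pos (hμm.trans hz.1.1)]
      exact hz.1.2.le
    obtain ⟨hw, hm⟩ := norm_w_m_le_of_mem_Uset (by omega) hμm hμ hz
    have hσ := frob_le_of_abs_apply_le (by positivity) (abs_sigma_apply_le_of_mem_Uset hμm he hz)
    gcongr
  refine ⟨hbound, ?_⟩
  obtain ⟨C, -, hC⟩ := hbound
  refine IsCompact.closure_of_subset (isCompact_Icc.prod ((isCompact_closedBall (0 : En n) C).prod
    ((isCompact_closedBall (0 : En n) C).prod (isCompact_S0_abs_apply_le n C))) :
      IsCompact (Set.Icc (-C) C ×ˢ _)) ?_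
  rintro _ ⟨z, hz, rfl⟩
  have h := hC z hz
  have h₁ := abs_nonneg z.1
  have h₂ := norm_nonneg z.2.1
  have h₃ := norm_nonneg z.2.2.1
  have h₄ : 0 ≤ frob (z.2.2.2.1 : Matrix (Fin n) (Fin n) ℝ) := Real.sqrt_nonneg _
  refine ⟨abs_le.mp (by dsimp only [pz]; linarith), mem_closedBall_zero_iff.mpr (by dsimp only [pz]; linarith),
    mem_closedBall_zero_iff.mpr (by dsimp only [pz]; linarith), fun i j => ?_⟩
  exact (abs_apply_le_frob _ i j).trans (by dsimp only [pz]; linarith)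
end
end
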